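/- arXiv:1110.1861 — 2 statements merged into one kernel-verified Lean document; each statement's English description precedes it below -/
import Mathlib

section
/- Let K be a field and c ∈ ℤⁿ with c⁺ ≠ 0 and c⁻ ≠ 0. Let I ⊆ S = K[x₁,…,xₙ] be an ideal homogeneous with respect to the ℤⁿ/ℤc-grading, let ≺ and ≺' be term orders with x^{c⁺} ≺ x^{c⁻} and x^{c⁺} ≻' x^{c⁻}, and set M = in_≺(I), N = in_{≺'}(I). Suppose r₁,…,rₙ ≥ 1 are integers with x_i^{r_i} ∈ M ∩ N for all 1 ≤ i ≤ n, and let Q = ⟨x₁^{r₁},…,xₙ^{rₙ}⟩. Then the colon ideals (Q : M) and (Q : N) are monomial ideals, and there exists an arrow map f̂ : Mon((Q : M)) → Mon((Q : N)) with respect to the ℤⁿ/ℤc-grading and the term order ≺. -/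
open MvPolynomial

/-- A term order on the monomial exponents of `K[x₁,…,xₙ]`: a strict total order on
`Fin n →₀ ℕ` with `0` smallest and compatible with addition. -/
def IsTermOrder (n : ℕ) (lt : (Fin n →₀ ℕ) → (Fin n →₀ ℕ) → Prop) : Prop :=
  (∀ u v : Fin n →₀ ℕ, lt u v ∨ u = v ∨ lt v u) ∧
  (∀ u v w : Fin n →₀ ℕ, lt u v → lt v w → lt u w) ∧
  (∀ u : Fin n →₀ ℕ, ¬ lt u u) ∧
  (∀ u : Fin n →₀ ℕ, u ≠ 0 → lt 0 u) ∧
  (∀ u v w : Fin n →₀ ℕ, lt u v → lt (u + w) (v + w))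

/-- `u` is the exponent of the `lt`-leading monomial `in_≺(f)` of `f`. -/
def IsLeadExp {n : ℕ} {K : Type*} [Field K] (lt : (Fin n →₀ ℕ) → (Fin n →₀ ℕ) → Prop)
    (f : MvPolynomial (Fin n) K) (u : Fin n →₀ ℕ) : Prop :=
  u ∈ f.support ∧ ∀ v ∈ f.support, v ≠ u → lt v u

/-- The initial ideal `in_≺(I)`, generated by the leading monomials of nonzero elements. -/
noncomputable def initialIdeal {n : ℕ} {K : Type*} [Field K]
    (lt : (Fin n →₀ ℕ) → (Fin n →₀ ℕ) → Prop) (I : Ideal (MvPolynomial (Fin n) K)) :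
    Ideal (MvPolynomial (Fin n) K) :=
  Ideal.span { p | ∃ f ∈ I, ∃ u, IsLeadExp lt f u ∧ p = monomial u 1 }

/-- `DistRel c u v ℓ` says that `u - v = ℓ·c` in `ℤⁿ`; then `d(x^u, x^v) = |ℓ|`. -/
def DistRel {n : ℕ} (c : Fin n → ℤ) (u v : Fin n →₀ ℕ) (ℓ : ℤ) : Prop :=
  ∀ i, (u i : ℤ) - (v i : ℤ) = ℓ * c i

/-- Two monomials have the same degree in the `ℤⁿ/ℤc`-grading iff `u - v ∈ ℤc`. -/
def SameDeg {n : ℕ} (c : Fin n → ℤ) (u v : Fin n →₀ ℕ) : Prop :=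
  ∃ ℓ : ℤ, DistRel c u v ℓ

/-- A polynomial is homogeneous for the `ℤⁿ/ℤc`-grading if all of its monomials
have the same degree. -/
def CHom {n : ℕ} {K : Type*} [Field K] (c : Fin n → ℤ) (f : MvPolynomial (Fin n) K) : Prop :=
  ∀ u ∈ f.support, ∀ v ∈ f.support, SameDeg c u v

/-- An ideal is homogeneous for the `ℤⁿ/ℤc`-grading if it is generated by homogeneous
elements. -/
def CHomIdeal {n : ℕ} {K : Type*} [Field K] (c : Fin n → ℤ)
    (I : Ideal (MvPolynomial (Fin n) K)) : Prop :=
  ∃ G : Set (MvPolynomial (Fin n) K), (∀ g ∈ G, CHom c g) ∧ I = Ideal.span G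

/-- The exponent vector `c⁺` of a vector `c ∈ ℤⁿ`. -/
noncomputable def cpos {n : ℕ} (c : Fin n → ℤ) : Fin n →₀ ℕ :=
  Finsupp.equivFunOnFinite.symm fun i => (c i).toNat

/-- The exponent vector `c⁻` of a vector `c ∈ ℤⁿ`. -/
noncomputable def cneg {n : ℕ} (c : Fin n → ℤ) : Fin n →₀ ℕ :=
  Finsupp.equivFunOnFinite.symm fun i => (-(c i)).toNat

/-- `Mon M`: the set of (exponents of) monomials lying in `M`. -/
def Mon {n : ℕ} {K : Type*} [Field K] (M : Ideal (MvPolynomial (Fin n) K)) :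
    Set (Fin n →₀ ℕ) :=
  { u | monomial u 1 ∈ M }

/-- `f` (as a map on exponent vectors) restricts to an arrow map `Mon M → Mon N`
with respect to the `ℤⁿ/ℤc`-grading and the term order `lt`:
(1) it is a degree-preserving bijection with `m ⪰ f(m)`;
(2) `d(m', f(m')) ≤ d(m, f(m))` for every multiple `m'` of `m ∈ Mon M`;
(3) `d(f⁻¹(m'), m') ≤ d(f⁻¹(m), m)` for every `m ∈ Mon N` and multiple `m'` of `m`. -/
def IsArrowMap {n : ℕ} {K : Type*} [Field K] (c : Fin n → ℤ)
    (lt : (Fin n →₀ ℕ) → (Fin n →₀ ℕ) → Prop)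
    (M N : Ideal (MvPolynomial (Fin n) K)) (f : (Fin n →₀ ℕ) → (Fin n →₀ ℕ)) : Prop :=
  Set.BijOn f (Mon M) (Mon N) ∧
  (∀ u ∈ Mon M, SameDeg c u (f u)) ∧
  (∀ u ∈ Mon M, f u = u ∨ lt (f u) u) ∧
  (∀ u ∈ Mon M, ∀ (w : Fin n →₀ ℕ) (ℓ ℓ' : ℤ),
    DistRel c u (f u) ℓ → DistRel c (u + w) (f (u + w)) ℓ' → |ℓ'| ≤ |ℓ|) ∧
  (∀ u ∈ Mon M, ∀ u' ∈ Mon M, ∀ (w : Fin n →₀ ℕ) (ℓ ℓ' : ℤ),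
    f u' = f u + w → DistRel c u (f u) ℓ → DistRel c u' (f u') ℓ' → |ℓ'| ≤ |ℓ|)

/-- A monomial ideal: an ideal generated by monomials. -/
def IsMonomialIdeal {n : ℕ} {K : Type*} [Field K] (M : Ideal (MvPolynomial (Fin n) K)) :
    Prop :=
  ∃ G : Set (Fin n →₀ ℕ), M = Ideal.span ((fun u => monomial u (1 : K)) '' G)

/-- The functional `φ` on `S` vanishes on `I`. -/
def AM.Van {n : ℕ} {K : Type*} [Field K] (I : Ideal (MvPolynomial (Fin n) K))
    (φ : MvPolynomial (Fin n) K →ₗ[K] K) : Prop := ∀ f ∈ I, φ f = 0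

/-- There is a functional vanishing on `I`, nonzero at `u`, and supported (on the fibre of `u`)
on `u, u - c, …, u - ℓ c`. -/
def AM.P {n : ℕ} {K : Type*} [Field K] (I : Ideal (MvPolynomial (Fin n) K))
    (c : Fin n → ℤ) (u : Fin n →₀ ℕ) (ℓ : ℕ) : Prop :=
  ∃ φ : MvPolynomial (Fin n) K →ₗ[K] K, AM.Van I φ ∧ φ (monomial u 1) ≠ 0 ∧
    ∀ v (k : ℤ), DistRel c u v k → (k < 0 ∨ (ℓ : ℤ) < k) → φ (monomial v 1) = 0

/-- Matching relation between standard monomials. -/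
def AM.R {n : ℕ} {K : Type*} [Field K] (I : Ideal (MvPolynomial (Fin n) K))
    (c : Fin n → ℤ) (u v : Fin n →₀ ℕ) (ℓ : ℕ) : Prop :=
  DistRel c u v ℓ ∧ AM.P I c u ℓ ∧ ∀ k < ℓ, ¬ AM.P I c u k

namespace AM

variable {n : ℕ} {K : Type*} [Field K] {I : Ideal (MvPolynomial (Fin n) K)}
  {c : Fin n → ℤ} {lt : (Fin n →₀ ℕ) → (Fin n →₀ ℕ) → Prop}

theorem DistRel.neg_symm {u v : Fin n →₀ ℕ} {k : ℤ} (h : DistRel c u v k) :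
    DistRel (-c) v u k := by
  intro i
  have := h i
  simp only [Pi.neg_apply]
  linarith

theorem DistRel.trans {u v w : Fin n →₀ ℕ} {k l : ℤ} (h : DistRel c u v k)
    (h' : DistRel c v w l) : DistRel c u w (k + l) := by
  intro i
  have := h i
  have := h' i
  linarith

theorem DistRel.symm {u v : Fin n →₀ ℕ} {k : ℤ} (h : DistRel c u v k) :
    DistRel c v u (-k) := by
  intro i
  have := h i
  linarith

theorem DistRel.right_unique {u v w : Fin n →₀ ℕ} {k : ℤ} (h : DistRel c u v k)
    (h' : DistRel c u w k) : v = w := by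
  ext i
  have := h i
  have := h' i
  omega

theorem DistRel.eq_of_zero {u v : Fin n →₀ ℕ} (h : DistRel c u v 0) : u = v := by
  ext i
  have := h i
  omega

theorem DistRel.unique (hc : c ≠ 0) {u v : Fin n →₀ ℕ} {k l : ℤ} (h : DistRel c u v k)
    (h' : DistRel c u v l) : k = l := by
  obtain ⟨i, hi⟩ := Function.ne_iff.1 hc
  exact mul_right_cancel₀ hi ((h i).symm.trans (h' i))

theorem ne_zero_of_cpos (h : cpos c ≠ 0) : c ≠ 0 := by
  rintro rfl
  apply h
  ext i
  simp [cpos]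

theorem exists_pos (h : cpos c ≠ 0) : ∃ i, 0 < c i := by
  obtain ⟨i, hi⟩ := Finsupp.ne_iff.1 h
  refine ⟨i, ?_⟩
  simp [cpos] at hi
  omega

theorem cpos_neg : cpos (-c) = cneg c := rfl

theorem cneg_neg : cneg (-c) = cpos c := by
  ext i
  simp [cpos, cneg]

theorem lt_nsmul (hlt : IsTermOrder n lt) {a b : Fin n →₀ ℕ} (h : lt a b) (k : ℕ) :
    lt ((k + 1) • a) ((k + 1) • b) := by
  obtain ⟨_, htr, _, _, hadd⟩ := hlt
  induction k with
  | zero => simpa using h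
  | succ k ih =>
    have h1 := hadd _ _ a ih
    have h2 := hadd _ _ ((k + 1) • b) h
    rw [succ_nsmul a (k + 1), succ_nsmul b (k + 1)]
    refine htr _ _ _ h1 ?_
    rw [add_comm ((k + 1) • b) a, add_comm ((k + 1) • b) b]
    exact h2

theorem lt_of_dist (hlt : IsTermOrder n lt) (hlo : lt (cpos c) (cneg c))
    {u v : Fin n →₀ ℕ} {k : ℤ} (h : DistRel c u v k) (hk : k < 0) : lt v u := by
  obtain ⟨m, rfl⟩ : ∃ m : ℕ, k = -((m : ℤ) + 1) := ⟨(-k - 1).toNat, by omega⟩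
  have h1 := lt_nsmul hlt hlo m
  obtain ⟨htot, htr, hirr, _, hadd⟩ := hlt
  have h2 := hadd _ _ u h1
  have h3 : (m + 1) • cpos c + u = v + (m + 1) • cneg c := by
    ext i
    have h4 := h i
    have h5 : c i = ((c i).toNat : ℤ) - ((-(c i)).toNat : ℤ) := by omega
    simp only [Finsupp.add_apply, Finsupp.smul_apply, smul_eq_mul, cpos, cneg,
      Finsupp.equivFunOnFinite_symm_apply_apply]
    zify
    rw [h5] at h4
    generalize ((c i).toNat : ℤ) = p at *
    generalize ((-(c i)).toNat : ℤ) = q at *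
    linarith
  rw [h3, add_comm _ u] at h2
  rcases htot v u with h' | h' | h'
  · exact h'
  · subst h'
    exact (hirr _ h2).elim
  · exact (hirr _ (htr _ _ _ h2 (hadd _ _ _ h'))).elim

theorem dist_neg_of_lt (hlt : IsTermOrder n lt) (hlo : lt (cpos c) (cneg c))
    {u v : Fin n →₀ ℕ} {k : ℤ} (h : DistRel c u v k) (huv : lt v u) : k < 0 := by
  by_contra hk
  rcases (not_lt.1 hk).eq_or_lt with hk | hk
  · subst hk
    rw [DistRel.eq_of_zero h] at huv
    exact hlt.2.2.1 _ huv
  · have := lt_of_dist hlt hlo (DistRel.symm h) (by omega)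
    exact hlt.2.2.1 _ (hlt.2.1 _ _ _ this huv)

theorem initial_eq : initialIdeal lt I =
    Ideal.span ((fun u => monomial u (1 : K)) '' {u | ∃ f ∈ I, IsLeadExp lt f u}) := by
  unfold initialIdeal
  congr 1
  ext p
  constructor
  · rintro ⟨f, hf, u, hu, rfl⟩
    exact ⟨u, ⟨f, hf, hu⟩, rfl⟩
  · rintro ⟨u, ⟨f, hf, hu⟩, rfl⟩
    exact ⟨f, hf, u, hu, rfl⟩

theorem mem_mon_span {G : Set (Fin n →₀ ℕ)} {u : Fin n →₀ ℕ} :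
    monomial u (1 : K) ∈ Ideal.span ((fun u => monomial u (1 : K)) '' G) ↔ ∃ a ∈ G, a ≤ u := by
  rw [MvPolynomial.mem_ideal_span_monomial_image]
  classical
  simp [MvPolynomial.support_monomial]

theorem lead_mul (hlt : IsTermOrder n lt) {f : MvPolynomial (Fin n) K} {a w : Fin n →₀ ℕ}
    (h : IsLeadExp lt f a) : IsLeadExp lt (f * monomial w 1) (a + w) := by
  constructor
  · have := h.1
    rw [MvPolynomial.mem_support_iff] at this ⊢
    rw [MvPolynomial.coeff_mul_monomial]
    simpa using this
  · intro v hv hne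
    rw [MvPolynomial.mem_support_iff, MvPolynomial.coeff_mul_monomial'] at hv
    split_ifs at hv with hw
    · have h1 : v - w + w = v := tsub_add_cancel_of_le hw
      rw [← h1]
      apply hlt.2.2.2.2
      apply h.2
      · rw [MvPolynomial.mem_support_iff]
        simpa using hv
      · intro h2
        rw [h2] at h1
        exact hne h1.symm
    · exact (hv rfl).elim

theorem mem_mon_initial (hlt : IsTermOrder n lt) {u : Fin n →₀ ℕ} :
    u ∈ Mon (initialIdeal lt I) ↔ ∃ f ∈ I, IsLeadExp lt f u := by
  rw [initial_eq]
  change monomial u (1 : K) ∈ Ideal.span _ ↔ _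
  rw [mem_mon_span]
  constructor
  · rintro ⟨a, ⟨f, hf, ha⟩, hau⟩
    refine ⟨f * monomial (u - a) 1, I.mul_mem_right _ hf, ?_⟩
    have := lead_mul (w := u - a) hlt ha
    rwa [add_tsub_cancel_of_le hau] at this
  · rintro h
    exact ⟨u, h, le_rfl⟩

theorem map_as_sum (φ : MvPolynomial (Fin n) K →ₗ[K] K) (f : MvPolynomial (Fin n) K) :
    φ f = ∑ v ∈ f.support, coeff v f * φ (monomial v 1) := by
  conv_lhs => rw [f.as_sum]
  rw [map_sum]
  refine Finset.sum_congr rfl fun v _ => ?_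
  have : monomial v (coeff v f) = coeff v f • monomial v (1 : K) := by
    rw [MvPolynomial.smul_monomial, smul_eq_mul, mul_one]
  rw [this, map_smul, smul_eq_mul]

/-- Truncation of a functional to the fibre of `u`. -/
theorem exists_trunc (hI : CHomIdeal c I) {φ : MvPolynomial (Fin n) K →ₗ[K] K} (hφ : Van I φ)
    (u : Fin n →₀ ℕ) : ∃ ψ : MvPolynomial (Fin n) K →ₗ[K] K, Van I ψ ∧
      (∀ v, SameDeg c u v → ψ (monomial v 1) = φ (monomial v 1)) ∧
      (∀ v, ¬ SameDeg c u v → ψ (monomial v 1) = 0) := by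
  classical
  let ψ : MvPolynomial (Fin n) K →ₗ[K] K := (MvPolynomial.basisMonomials (Fin n) K).constr K
    (fun v => if SameDeg c u v then φ (monomial v 1) else 0)
  have hψ : ∀ v, ψ (monomial v 1) = if SameDeg c u v then φ (monomial v 1) else 0 := by
    intro v
    have h1 : (monomial v (1 : K)) = MvPolynomial.basisMonomials (Fin n) K v := by simp
    rw [h1]
    simp only [ψ, Module.Basis.constr_basis]
    simp
  refine ⟨ψ, ?_, fun v hv => by rw [hψ, if_pos hv], fun v hv => by rw [hψ, if_neg hv]⟩
  obtain ⟨G, hG, rfl⟩ := hI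
  intro f hf
  induction hf using Submodule.closure_induction with
  | zero => simp
  | add x y _ _ hx hy => rw [map_add, hx, hy, add_zero]
  | smul_mem p g hg =>
    induction p using MvPolynomial.induction_on' with
    | add p q hp hq => rw [add_smul, map_add, hp, hq, add_zero]
    | monomial w a =>
      have hmem : monomial w a • g ∈ Ideal.span G :=
        Submodule.smul_mem _ _ (Ideal.subset_span hg)
      have hhom : CHom c (monomial w a • g) := by
        intro x hx y hy
        rw [MvPolynomial.mem_support_iff, smul_eq_mul, mul_comm,
          MvPolynomial.coeff_mul_monomial'] at hx hy
        split_ifs at hx hy with h1 h2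
        · obtain ⟨l, hl⟩ := hG g hg (x - w) (by
            rw [MvPolynomial.mem_support_iff]; exact left_ne_zero_of_mul hx) (y - w) (by
            rw [MvPolynomial.mem_support_iff]; exact left_ne_zero_of_mul hy)
          refine ⟨l, fun i => ?_⟩
          rw [← hl i]
          have := h1 i
          have := h2 i
          simp only [Finsupp.tsub_apply]
          omega
        all_goals simp at hx hy
      generalize monomial w a • g = f at hmem hhom
      by_cases h : ∃ v ∈ f.support, SameDeg c u v
      · obtain ⟨v, hv, l, hl⟩ := h
        rw [← hφ f hmem, map_as_sum ψ, map_as_sum φ]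
        refine Finset.sum_congr rfl fun x hx => ?_
        obtain ⟨m, hm⟩ := hhom v hv x hx
        rw [hψ, if_pos ⟨_, DistRel.trans hl hm⟩]
      · push Not at h
        rw [map_as_sum]
        refine Finset.sum_eq_zero fun x hx => ?_
        rw [hψ, if_neg (h x hx), mul_zero]

theorem not_mem_mon (hlt : IsTermOrder n lt) (hlo : lt (cpos c) (cneg c)) (hcp : cpos c ≠ 0)
    (hI : CHomIdeal c I) {u : Fin n →₀ ℕ} :
    u ∉ Mon (initialIdeal lt I) ↔ ∃ ℓ, P I c u ℓ := by
  rw [mem_mon_initial hlt]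
  constructor
  · intro h
    let W : Submodule K (MvPolynomial (Fin n) K) :=
      Submodule.span K ((fun v => monomial v (1 : K)) '' {v | ∃ k < 0, DistRel c u v k})
    have hWs : ∀ g ∈ W, ∀ v ∈ g.support, lt v u := by
      intro g hg
      induction hg using Submodule.span_induction with
      | zero => simp
      | add x y _ _ hx hy =>
        classical
        intro v hv
        rcases Finset.mem_union.1 (MvPolynomial.support_add hv) with h | h
        · exact hx v h
        · exact hy v h
      | smul a x _ hx =>
        intro v hv
        exact hx v (MvPolynomial.support_smul hv)
      | mem x hx =>
        obtain ⟨w, ⟨k, hk, hd⟩, rfl⟩ := hx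
        intro v hv
        have := MvPolynomial.support_monomial_subset hv
        rw [Finset.mem_singleton] at this
        subst this
        exact lt_of_dist hlt hlo hd hk
    have hnot : monomial u (1 : K) ∉ I.restrictScalars K ⊔ W := by
      intro hmem
      obtain ⟨f, hf, g, hg, hfg⟩ := Submodule.mem_sup.1 hmem
      apply h
      have hcoeff : ∀ v, v ≠ u → coeff v f = - coeff v g := by
        intro v hv
        have := congrArg (coeff v) hfg
        rw [MvPolynomial.coeff_add, MvPolynomial.coeff_monomial, if_neg (Ne.symm hv)] at this
        exact eq_neg_of_add_eq_zero_left this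
      refine ⟨f, hf, ?_, ?_⟩
      · have hgu : coeff u g = 0 := by
          by_contra h'
          exact hlt.2.2.1 u (hWs g hg u (MvPolynomial.mem_support_iff.2 h'))
        have := congrArg (coeff u) hfg
        rw [MvPolynomial.coeff_add, hgu, add_zero, MvPolynomial.coeff_monomial, if_pos rfl] at this
        rw [MvPolynomial.mem_support_iff, this]
        exact one_ne_zero
      · intro v hv hne
        refine hWs g hg v ?_
        rw [MvPolynomial.mem_support_iff, hcoeff v hne] at hv
        rw [MvPolynomial.mem_support_iff]
        simpa using hv
    obtain ⟨φ, hφu, hφ⟩ := Submodule.exists_le_ker_of_notMem hnot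
    obtain ⟨i, hi⟩ := exists_pos hcp
    refine ⟨u i, φ, fun f hf => ?_, hφu, ?_⟩
    · exact hφ (Submodule.mem_sup_left (by simpa using hf))
    · rintro v k hd (hk | hk)
      · exact hφ (Submodule.mem_sup_right (Submodule.subset_span ⟨v, ⟨k, hk, hd⟩, rfl⟩))
      · exfalso
        have := hd i
        nlinarith
  · rintro ⟨ℓ, φ, hφ, hφu, hv⟩ ⟨f, hf, hlead⟩
    obtain ⟨ψ, hψ, h1, h2⟩ := exists_trunc hI hφ u
    have h0 := hψ f hf
    rw [map_as_sum, Finset.sum_eq_single_of_mem u hlead.1] at h0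
    · rw [h1 u ⟨0, fun i => by simp⟩] at h0
      exact mul_ne_zero (MvPolynomial.mem_support_iff.1 hlead.1) hφu h0
    · intro v hvs hne
      by_cases hs : SameDeg c u v
      · rw [h1 v hs]
        obtain ⟨k, hk⟩ := hs
        rw [hv v k hk (Or.inl (dist_neg_of_lt hlt hlo hk (hlead.2 v hvs hne))), mul_zero]
      · rw [h2 v hs, mul_zero]

theorem P.of_add {u w : Fin n →₀ ℕ} {ℓ : ℕ} (h : P I c (u + w) ℓ) : P I c u ℓ := by
  obtain ⟨φ, hφ, hu, hv⟩ := h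
  refine ⟨φ ∘ₗ LinearMap.mulRight K (monomial w 1), fun f hf => ?_, ?_, fun v k hd hk => ?_⟩
  · exact hφ _ (I.mul_mem_right _ hf)
  · simpa using hu
  · have := hv (v + w) k (fun i => by have := hd i; simp; linarith) hk
    simpa using this

theorem exists_R {u : Fin n →₀ ℕ} {ℓ : ℕ} (h : P I c u ℓ) : ∃ v k, R I c u v k := by
  classical
  have hex : ∃ ℓ, P I c u ℓ := ⟨ℓ, h⟩
  have hmin : ∀ k < Nat.find hex, ¬ P I c u k := fun k hk => Nat.find_min hex hk
  have hs := Nat.find_spec hex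
  generalize Nat.find hex = m at hmin hs
  by_cases hv : ∃ v, DistRel c u v m
  · obtain ⟨v, hv⟩ := hv
    exact ⟨v, m, hv, hs, hmin⟩
  · exfalso
    cases m with
    | zero => exact hv ⟨u, fun i => by simp⟩
    | succ m =>
      obtain ⟨φ, hφ, hu, hz⟩ := hs
      refine hmin m (Nat.lt_succ_self m) ⟨φ, hφ, hu, fun v k hd hk => ?_⟩
      rcases hk with hk | hk
      · exact hz v k hd (Or.inl hk)
      · by_cases hk' : k = (m + 1 : ℕ)
        · exact (hv ⟨v, hk' ▸ hd⟩).elim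
        · exact hz v k hd (Or.inr (by omega))

theorem R.symm {u v : Fin n →₀ ℕ} {ℓ : ℕ} (h : R I c u v ℓ) : R I (-c) v u ℓ := by
  obtain ⟨hd, ⟨φ, hφ, hu, hz⟩, hmin⟩ := h
  have hdd : ∀ w k, DistRel (-c) v w k → DistRel c u w (ℓ - k) := by
    intro w k h i
    have := hd i
    have := h i
    simp only [Pi.neg_apply] at this
    linarith
  have hv : φ (monomial v 1) ≠ 0 := by
    intro h0
    cases ℓ with
    | zero =>
      have := DistRel.eq_of_zero (by simpa using hd)
      subst this
      exact hu h0
    | succ m =>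
      refine hmin m (Nat.lt_succ_self m) ⟨φ, hφ, hu, fun w k hdw hk => ?_⟩
      rcases hk with hk | hk
      · exact hz w k hdw (Or.inl hk)
      · by_cases hk' : k = (m + 1 : ℕ)
        · subst hk'
          rw [← DistRel.right_unique hd hdw]
          exact h0
        · exact hz w k hdw (Or.inr (by omega))
  refine ⟨DistRel.neg_symm hd, ⟨φ, hφ, hv, fun w k hdw hk => ?_⟩, ?_⟩
  · exact hz w _ (hdd w k hdw) (by omega)
  · rintro l hl ⟨ψ, hψ, hψv, hψz⟩
    obtain ⟨m, rfl⟩ : ∃ m, ℓ = m + 1 := ⟨ℓ - 1, by omega⟩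
    refine hmin m (Nat.lt_succ_self m)
      ⟨φ - (φ (monomial v 1) / ψ (monomial v 1)) • ψ, fun f hf => ?_, ?_, fun w k hdw hk => ?_⟩
    · simp [hφ f hf, hψ f hf]
    · have : ψ (monomial u 1) = 0 := hψz u _ (DistRel.neg_symm hd) (Or.inr (by omega))
      simpa [this] using hu
    · have hvw : DistRel (-c) v w ((m + 1 : ℕ) - k) := by
        intro i
        have := hd i
        have := hdw i
        simp only [Pi.neg_apply]
        linarith
      by_cases hk' : k = (m + 1 : ℕ)
      · subst hk'
        rw [← DistRel.right_unique hd hdw]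
        simp [hψv]
      · have h1 : φ (monomial w 1) = 0 := hz w k hdw (by omega)
        have h2 : ψ (monomial w 1) = 0 := hψz w _ hvw (by omega)
        simp [h1, h2]

theorem R.unique {u v v' : Fin n →₀ ℕ} {ℓ ℓ' : ℕ} (h : R I c u v ℓ) (h' : R I c u v' ℓ') :
    ℓ = ℓ' ∧ v = v' := by
  have : ℓ = ℓ' := by
    rcases lt_trichotomy ℓ ℓ' with hl | hl | hl
    · exact (h'.2.2 _ hl h.2.1).elim
    · exact hl
    · exact (h.2.2 _ hl h'.2.1).elim
  subst this
  exact ⟨rfl, DistRel.right_unique h.1 h'.1⟩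

theorem R.le_of_add {u w v v' : Fin n →₀ ℕ} {ℓ ℓ' : ℕ} (h : R I c (u + w) v ℓ)
    (h' : R I c u v' ℓ') : ℓ' ≤ ℓ := by
  by_contra hl
  exact h'.2.2 _ (not_le.1 hl) h.2.1.of_add


theorem mem_Q {r : Fin n → ℕ} {f : MvPolynomial (Fin n) K} :
    f ∈ Ideal.span (Set.range fun i : Fin n => monomial (Finsupp.single i (r i)) (1 : K)) ↔
      ∀ v ∈ f.support, ∃ i, r i ≤ v i := by
  have : (Set.range fun i : Fin n => monomial (Finsupp.single i (r i)) (1 : K)) =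
      (fun u => monomial u (1 : K)) '' (Set.range fun i : Fin n => Finsupp.single i (r i)) := by
    rw [← Set.range_comp]
    rfl
  rw [this, MvPolynomial.mem_ideal_span_monomial_image]
  simp [Finsupp.single_le_iff]

theorem mem_colon_Q {r : Fin n → ℕ} {G : Set (Fin n →₀ ℕ)} {f : MvPolynomial (Fin n) K} :
    f ∈ (Ideal.span (Set.range fun i : Fin n =>
        monomial (Finsupp.single i (r i)) (1 : K))).colon
        (Ideal.span ((fun u => monomial u (1 : K)) '' G) : Ideal (MvPolynomial (Fin n) K)) ↔
      ∀ v ∈ f.support, ∀ a ∈ G, ∃ i, r i ≤ v i + a i := by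
  rw [Ideal.colon_span, Submodule.mem_colon, Set.forall_mem_image]
  simp only [smul_eq_mul, mem_Q]
  constructor
  · intro h v hv a ha
    have := h ha (v + a) (by
      rw [MvPolynomial.mem_support_iff] at hv ⊢
      rw [MvPolynomial.coeff_mul_monomial]
      simpa using hv)
    simpa using this
  · intro h a ha v hv
    rw [MvPolynomial.mem_support_iff, MvPolynomial.coeff_mul_monomial'] at hv
    split_ifs at hv with hav
    · obtain ⟨i, hi⟩ := h (v - a) (by
        rw [MvPolynomial.mem_support_iff]; simpa using hv) a ha
      refine ⟨i, ?_⟩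
      have := hav i
      simp only [Finsupp.tsub_apply] at hi
      omega
    · exact (hv rfl).elim

theorem isMonomialIdeal_colon {r : Fin n → ℕ} {G : Set (Fin n →₀ ℕ)} :
    IsMonomialIdeal ((Ideal.span (Set.range fun i : Fin n =>
        monomial (Finsupp.single i (r i)) (1 : K))).colon
        (Ideal.span ((fun u => monomial u (1 : K)) '' G) : Ideal (MvPolynomial (Fin n) K))) := by
  refine ⟨{v | ∀ a ∈ G, ∃ i, r i ≤ v i + a i}, ?_⟩
  ext f
  rw [mem_colon_Q, MvPolynomial.mem_ideal_span_monomial_image]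
  constructor
  · intro h v hv
    exact ⟨v, h v hv, le_rfl⟩
  · intro h v hv a ha
    obtain ⟨w, hw, hwv⟩ := h v hv
    obtain ⟨i, hi⟩ := hw a ha
    have := hwv i
    exact ⟨i, by omega⟩

/-- The socle exponent of `Q`. -/
noncomputable def soc (r : Fin n → ℕ) : Fin n →₀ ℕ :=
  Finsupp.equivFunOnFinite.symm fun i => r i - 1

theorem soc_apply (r : Fin n → ℕ) (i : Fin n) : soc r i = r i - 1 := rfl

theorem mem_mon_colon {r : Fin n → ℕ} {G : Set (Fin n →₀ ℕ)} {u : Fin n →₀ ℕ}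
    (hr : ∀ i, 1 ≤ r i) :
    u ∈ Mon ((Ideal.span (Set.range fun i : Fin n =>
        monomial (Finsupp.single i (r i)) (1 : K))).colon
        (Ideal.span ((fun u => monomial u (1 : K)) '' G) : Ideal (MvPolynomial (Fin n) K))) ↔
      ((∀ i, u i < r i) →
        soc r - u ∉ Mon (Ideal.span ((fun u => monomial u (1 : K)) '' G))) := by
  change monomial u (1 : K) ∈ Submodule.colon _ _ ↔ (_ → ¬ (monomial _ (1 : K) ∈ Ideal.span _))
  rw [mem_colon_Q, mem_mon_span]
  have hs : ∀ v ∈ (monomial u (1 : K)).support, v = u := fun v hv => by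
    simpa using MvPolynomial.support_monomial_subset hv
  have hs' : u ∈ (monomial u (1 : K)).support := by simp
  constructor
  · rintro h hB ⟨a, ha, hle⟩
    obtain ⟨i, hi⟩ := h u hs' a ha
    have h1 := hle i
    have h2 := hB i
    have h3 := hr i
    simp only [Finsupp.tsub_apply, soc_apply] at h1
    omega
  · intro h v hv a ha
    rw [hs v hv]
    by_contra! hcon
    refine h (fun i => ?_) ⟨a, ha, fun i => ?_⟩
    · have := hcon i
      omega
    · have := hcon i
      simp only [Finsupp.tsub_apply, soc_apply]
      omega

theorem main (hcp : cpos c ≠ 0) (J J' : Ideal (MvPolynomial (Fin n) K))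
    (hlt : IsTermOrder n lt) (hlo : lt (cpos c) (cneg c))
    (A A' : Set (Fin n →₀ ℕ)) (hA : ∀ u, u ∉ A ↔ ∃ ℓ, P I c u ℓ)
    (hA' : ∀ u, u ∉ A' ↔ ∃ ℓ, P I (-c) u ℓ)
    (r : Fin n → ℕ)
    (hrA : ∀ u, u ∉ A → ∀ i, u i < r i) (hrA' : ∀ u, u ∉ A' → ∀ i, u i < r i)
    (hJ : ∀ u, u ∈ Mon J ↔ ((∀ i, u i < r i) → soc r - u ∉ A))
    (hJ' : ∀ u, u ∈ Mon J' ↔ ((∀ i, u i < r i) → soc r - u ∉ A')) :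
    ∃ f : (Fin n →₀ ℕ) → (Fin n →₀ ℕ), IsArrowMap c lt J J' f := by
  classical
  have hc := ne_zero_of_cpos hcp
  let B : (Fin n →₀ ℕ) → Prop := fun u => ∀ i, u i < r i
  have hss : ∀ u, B u → soc r - (soc r - u) = u := by
    intro u hu
    ext i
    have := hu i
    simp only [Finsupp.tsub_apply, soc_apply]
    omega
  have hsB : ∀ u v, B v → B (soc r - u) := by
    intro u v hv i
    have := hv i
    simp only [Finsupp.tsub_apply, soc_apply]
    omega
  have hB1 : ∀ {u v ℓ}, R I c u v ℓ → B u := fun h => hrA _ ((hA _).2 ⟨_, h.2.1⟩)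
  have hB2 : ∀ {u v ℓ}, R I c u v ℓ → v ∉ A' := fun h => (hA' _).2 ⟨_, h.symm.2.1⟩
  let f : (Fin n →₀ ℕ) → (Fin n →₀ ℕ) := fun u =>
    if h : B u ∧ ∃ v ℓ, R I c (soc r - u) v ℓ then soc r - h.2.choose else u
  have hf1 : ∀ u, ¬ B u → f u = u := fun u hu => dif_neg fun h => hu h.1
  have hf2 : ∀ u ∈ Mon J, B u → ∃ ℓ, R I c (soc r - u) (soc r - f u) ℓ ∧ B (f u) := by
    intro u hu hB
    have hex : ∃ v ℓ, R I c (soc r - u) v ℓ := by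
      obtain ⟨ℓ, hℓ⟩ := (hA _).1 ((hJ u).1 hu hB)
      exact exists_R hℓ
    have hfu : f u = soc r - hex.choose := dif_pos ⟨hB, hex⟩
    obtain ⟨ℓ, hℓ⟩ := hex.choose_spec
    have hBv : B hex.choose := hrA' _ (hB2 hℓ)
    rw [hfu]
    refine ⟨ℓ, ?_, hsB _ _ hB⟩
    rw [hss _ hBv]
    exact hℓ
  have hdist : ∀ u v (ℓ : ℤ), B u → B v → DistRel c (soc r - u) (soc r - v) ℓ →
      DistRel c u v (-ℓ) := by
    intro u v ℓ hu hv h i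
    have h1 := h i
    have h2 := hu i
    have h3 := hv i
    simp only [Finsupp.tsub_apply, soc_apply] at h1
    rw [neg_mul, ← h1]
    omega
  have hBf : ∀ u ∈ Mon J, (B (f u) ↔ B u) := by
    intro u hu
    by_cases hB : B u
    · obtain ⟨ℓ, _, h⟩ := hf2 u hu hB
      exact ⟨fun _ => hB, fun _ => h⟩
    · rw [hf1 u hB]
  have hself : ∀ u, DistRel c u u 0 := fun u i => by simp
  refine ⟨f, ⟨?_, ?_, ?_⟩, ?_, ?_, ?_, ?_⟩
  · intro u hu
    rw [hJ']
    intro hB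
    obtain ⟨ℓ, hR, _⟩ := hf2 u hu ((hBf u hu).1 hB)
    exact hB2 hR
  · intro u hu u' hu' he
    by_cases hB : B u
    · have hB' : B u' := by rw [← hBf u' hu', ← he, hBf u hu]; exact hB
      obtain ⟨ℓ, hR, _⟩ := hf2 u hu hB
      obtain ⟨ℓ', hR', _⟩ := hf2 u' hu' hB'
      rw [← he] at hR'
      have := (hR.symm.unique hR'.symm).2
      rw [← hss u hB, this, hss u' hB']
    · have hB' : ¬ B u' := by rw [← hBf u' hu', ← he, hBf u hu]; exact hB
      rwa [hf1 u hB, hf1 u' hB'] at he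
  · intro v hv
    by_cases hB : B v
    · obtain ⟨k, hk⟩ := (hA' _).1 ((hJ' v).1 hv hB)
      obtain ⟨m, ℓ, hR⟩ := exists_R hk
      have hR' := hR.symm
      rw [neg_neg] at hR'
      have hBm := hB1 hR'
      have hmem : soc r - m ∈ Mon J := by
        rw [hJ]
        intro _
        rw [hss m hBm]
        exact (hA _).2 ⟨_, hR'.2.1⟩
      obtain ⟨l, hl, hBl⟩ := hf2 _ hmem (hsB m v hB)
      rw [hss m hBm] at hl
      refine ⟨soc r - m, hmem, ?_⟩
      have := (hl.unique hR').2
      rw [← hss _ hBl, this, hss v hB]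
    · exact ⟨v, (hJ v).2 fun h => (hB h).elim, hf1 v hB⟩
  · intro u hu
    by_cases hB : B u
    · obtain ⟨ℓ, hR, h⟩ := hf2 u hu hB
      exact ⟨_, hdist _ _ _ hB h hR.1⟩
    · rw [hf1 u hB]
      exact ⟨0, hself u⟩
  · intro u hu
    by_cases hB : B u
    · obtain ⟨ℓ, hR, h⟩ := hf2 u hu hB
      have hd := hdist _ _ _ hB h hR.1
      rcases Nat.eq_zero_or_pos ℓ with h0 | h0
      · subst h0
        left
        exact (DistRel.eq_of_zero (by simpa using hd)).symm
      · right
        exact lt_of_dist hlt hlo hd (by omega)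
    · exact Or.inl (hf1 u hB)
  · intro u hu w ℓ ℓ' h h'
    by_cases hB : B (u + w)
    · have hBu : B u := fun i => lt_of_le_of_lt (by simp) (hB i)
      have huw : u + w ∈ Mon J := by
        change monomial (u + w) (1 : K) ∈ J
        have : monomial (u + w) (1 : K) = monomial u 1 * monomial w 1 := by
          rw [MvPolynomial.monomial_mul, one_mul]
        rw [this]
        exact J.mul_mem_right _ hu
      obtain ⟨l, hR, hb⟩ := hf2 u hu hBu
      obtain ⟨l', hR', hb'⟩ := hf2 _ huw hB
      have e1 := DistRel.unique hc h (hdist _ _ _ hBu hb hR.1)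
      have e2 := DistRel.unique hc h' (hdist _ _ _ hB hb' hR'.1)
      have e3 : soc r - u = (soc r - (u + w)) + w := by
        ext i
        have := hB i
        simp only [Finsupp.tsub_apply, Finsupp.add_apply, soc_apply] at this ⊢
        omega
      rw [e3] at hR
      have := hR.le_of_add hR'
      rw [e1, e2]
      simpa using this
    · rw [hf1 _ hB] at h'
      rw [DistRel.unique hc h' (hself _)]
      simp
  · intro u hu u' hu' w ℓ ℓ' he h h'
    by_cases hB : B u'
    · have hBf' := (hBf u' hu').2 hB
      have hBfu : B (f u) := fun i => lt_of_le_of_lt (by rw [he]; simp) (hBf' i)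
      have hBu := (hBf u hu).1 hBfu
      obtain ⟨l, hR, hb⟩ := hf2 u hu hBu
      obtain ⟨l', hR', hb'⟩ := hf2 _ hu' hB
      have e1 := DistRel.unique hc h (hdist _ _ _ hBu hb hR.1)
      have e2 := DistRel.unique hc h' (hdist _ _ _ hB hb' hR'.1)
      have e3 : soc r - f u = (soc r - f u') + w := by
        ext i
        have := hBf' i
        rw [he] at this ⊢
        simp only [Finsupp.tsub_apply, Finsupp.add_apply, soc_apply] at this ⊢
        omega
      have hS := hR.symm
      rw [e3] at hS
      have := hS.le_of_add hR'.symm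
      rw [e1, e2]
      simpa using this
    · rw [hf1 _ hB] at h'
      rw [DistRel.unique hc h' (hself _)]
      simp

theorem bound_of_not_mem {M : Ideal (MvPolynomial (Fin n) K)} {r : Fin n → ℕ}
    (hrM : ∀ i, (monomial (Finsupp.single i (r i)) (1 : K)) ∈ M) (u : Fin n →₀ ℕ)
    (hu : u ∉ Mon M) (i : Fin n) : u i < r i := by
  by_contra! h
  apply hu
  change monomial u (1 : K) ∈ M
  have hle : Finsupp.single i (r i) ≤ u := by simpa [Finsupp.single_le_iff] using h
  have : monomial u (1 : K) = monomial (Finsupp.single i (r i)) 1 *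
      monomial (u - Finsupp.single i (r i)) 1 := by
    rw [MvPolynomial.monomial_mul, one_mul, add_tsub_cancel_of_le hle]
  rw [this]
  exact M.mul_mem_right _ (hrM i)

theorem CHomIdeal.neg (h : CHomIdeal c I) : CHomIdeal (-c) I := by
  obtain ⟨G, hG, rfl⟩ := h
  refine ⟨G, fun g hg u hu v hv => ?_, rfl⟩
  obtain ⟨k, hk⟩ := hG g hg v hv u hu
  exact ⟨k, DistRel.neg_symm hk⟩

end AM

/-- (Theorem 1.3(2).) With `M = in_≺(I)`, `N = in_≺'(I)` as before, if
`x_i^{r_i} ∈ M ∩ N` for all `i` and `Q = ⟨x₁^{r₁},…,xₙ^{rₙ}⟩`, then `(Q : M)` and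
`(Q : N)` are monomial ideals and there is an arrow map
`f̂ : Mon (Q : M) → Mon (Q : N)` with respect to the `ℤⁿ/ℤc`-grading and `≺`. -/
theorem arrow_map_of_colon_ideals {n : ℕ} {K : Type*} [Field K] (c : Fin n → ℤ)
    (hcp : cpos c ≠ 0) (hcn : cneg c ≠ 0)
    (lt lt' : (Fin n →₀ ℕ) → (Fin n →₀ ℕ) → Prop)
    (hlt : IsTermOrder n lt) (hlt' : IsTermOrder n lt')
    (hlo : lt (cpos c) (cneg c)) (hlo' : lt' (cneg c) (cpos c))
    (I : Ideal (MvPolynomial (Fin n) K)) (hI : CHomIdeal c I)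
    (M N : Ideal (MvPolynomial (Fin n) K))
    (hM : M = initialIdeal lt I) (hN : N = initialIdeal lt' I)
    (r : Fin n → ℕ) (hr : ∀ i, 1 ≤ r i)
    (hrM : ∀ i, (monomial (Finsupp.single i (r i)) (1 : K)) ∈ M)
    (hrN : ∀ i, (monomial (Finsupp.single i (r i)) (1 : K)) ∈ N)
    (Q : Ideal (MvPolynomial (Fin n) K))
    (hQ : Q = Ideal.span (Set.range fun i : Fin n =>
      monomial (Finsupp.single i (r i)) (1 : K))) :
    IsMonomialIdeal (Q.colon M) ∧ IsMonomialIdeal (Q.colon N) ∧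
      ∃ f : (Fin n →₀ ℕ) → (Fin n →₀ ℕ), IsArrowMap c lt (Q.colon M) (Q.colon N) f := by

  subst hM hN hQ
  refine ⟨?_, ?_, ?_⟩
  · rw [AM.initial_eq]
    exact AM.isMonomialIdeal_colon
  · rw [AM.initial_eq]
    exact AM.isMonomialIdeal_colon
  · refine AM.main (I := I) hcp _ _ hlt hlo (Mon (initialIdeal lt I)) (Mon (initialIdeal lt' I))
      (fun u => AM.not_mem_mon hlt hlo hcp hI)
      (fun u => AM.not_mem_mon hlt' (by rwa [AM.cneg_neg, AM.cpos_neg])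
        (by rwa [AM.cpos_neg]) (AM.CHomIdeal.neg hI)) r
      (AM.bound_of_not_mem hrM) (AM.bound_of_not_mem hrN) ?_ ?_
    · intro u
      rw [AM.initial_eq]
      exact AM.mem_mon_colon hr
    · intro u
      rw [AM.initial_eq]
      exact AM.mem_mon_colon hr
end

section
/- Let K be a field, let r₁,…,rₙ ≥ 1 be integers, let Q = ⟨x₁^{r₁},…,xₙ^{rₙ}⟩ ⊆ S = K[x₁,…,xₙ], and let I be an ideal of S with Q ⊆ I. Then for every term order ≺ on S, in_≺(Q : I) = (Q : in_≺(I)). -/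
open MvPolynomial

lemma mem_Q_iff {n : ℕ} {K : Type*} [Field K]
    (r : Fin n → ℕ) (hr : ∀ i, 1 ≤ r i) (s : Fin n →₀ ℕ) (hs : ∀ i, s i = r i - 1)
    (p : MvPolynomial (Fin n) K) :
    p ∈ Ideal.span (Set.range fun i : Fin n => monomial (Finsupp.single i (r i)) (1 : K)) ↔
      ∀ b, b ≤ s → coeff b p = 0 := by
  have h : (Set.range fun i : Fin n => monomial (Finsupp.single i (r i)) (1 : K)) =
      (fun u => monomial u (1 : K)) '' (Set.range fun i : Fin n => Finsupp.single i (r i)) := by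
    rw [← Set.range_comp]; rfl
  rw [h, mem_ideal_span_monomial_image]
  have key : ∀ b : Fin n →₀ ℕ,
      (∃ si ∈ Set.range fun i : Fin n => Finsupp.single i (r i), si ≤ b) ↔ ¬ b ≤ s := by
    intro b
    simp only [Set.exists_range_iff, Finsupp.le_def (g := s), not_forall, hs]
    refine exists_congr fun i => ?_
    rw [Finsupp.single_le_iff]
    have := hr i
    omega
  simp only [key, mem_support_iff]
  exact forall_congr' fun b => by tauto

lemma lt_sub {n : ℕ} {lt : (Fin n →₀ ℕ) → (Fin n →₀ ℕ) → Prop} (hlt : IsTermOrder n lt)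
    {s u v : Fin n →₀ ℕ} (hu : u ≤ s) (hv : v ≤ s) (h : lt u v) : lt (s - v) (s - u) := by
  obtain ⟨h1, h2, h3, h4, h5⟩ := hlt
  have a1 : u + (s - u) = s := add_tsub_cancel_of_le hu
  have a2 : v + (s - v) = s := add_tsub_cancel_of_le hv
  rcases h1 (s - v) (s - u) with h' | h' | h'
  · exact h'
  · exfalso
    have := h5 u v (s - u) h
    rw [a1, ← h', a2] at this
    exact h3 _ this
  · exfalso
    have e1 := h5 u v (s - u) h
    have e2 := h5 _ _ v h'
    rw [a1] at e1
    rw [add_comm, add_comm (s - v), a2] at e2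
    exact h3 _ (h2 _ _ _ e1 e2)

lemma coeff_lead {n : ℕ} {K : Type*} [Field K] {lt : (Fin n →₀ ℕ) → (Fin n →₀ ℕ) → Prop}
    (hlt : IsTermOrder n lt) {f g : MvPolynomial (Fin n) K} {u v : Fin n →₀ ℕ}
    (hf : IsLeadExp lt f u) (hg : IsLeadExp lt g v) : coeff (u + v) (f * g) ≠ 0 := by
  obtain ⟨h1, h2, h3, h4, h5⟩ := hlt
  rw [coeff_mul, Finset.sum_eq_single (u, v)]
  · exact mul_ne_zero (mem_support_iff.1 hf.1) (mem_support_iff.1 hg.1)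
  · rintro ⟨a, b⟩ hab hne
    rw [Finset.HasAntidiagonal.mem_antidiagonal] at hab
    by_contra hc
    have ha : a ∈ f.support := mem_support_iff.2 (left_ne_zero_of_mul hc)
    have hb : b ∈ g.support := mem_support_iff.2 (right_ne_zero_of_mul hc)
    simp only at hab
    by_cases hau : a = u
    · subst hau
      exact hne (by rw [add_left_cancel hab])
    · have e1 := h5 _ _ b (hf.2 a ha hau)
      rw [hab] at e1
      by_cases hbv : b = v
      · subst hbv; exact h3 _ e1
      · have e2 := h5 _ _ u (hg.2 b hb hbv)
        rw [add_comm, add_comm v] at e2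
        exact h3 _ (h2 _ _ _ e1 e2)
  · intro h; simp at h

lemma exists_functional {n : ℕ} {K : Type*} [Field K]
    {lt : (Fin n →₀ ℕ) → (Fin n →₀ ℕ) → Prop} (hlt : IsTermOrder n lt)
    (I : Ideal (MvPolynomial (Fin n) K)) (w : Fin n →₀ ℕ)
    (hw : ∀ g ∈ I, ¬ IsLeadExp lt g w) :
    ∃ φ : MvPolynomial (Fin n) K →ₗ[K] K, (∀ p ∈ I, φ p = 0) ∧
      (∀ v, lt v w → φ (monomial v 1) = 0) ∧ φ (monomial w 1) ≠ 0 := by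
  have hnot : (monomial w (1 : K)) ∉
      I.restrictScalars K ⊔ restrictSupport K {v | lt v w} := by
    intro hmem
    obtain ⟨g, hg, h, hh, he⟩ := Submodule.mem_sup.1 hmem
    rw [mem_restrictSupport_iff] at hh
    have hh' : ∀ v, coeff v h ≠ 0 → lt v w := fun v hv => hh (mem_support_iff.2 hv)
    have hwh : coeff w h = 0 := by
      by_contra hc; exact hlt.2.2.1 _ (hh' w hc)
    refine hw g hg ⟨?_, ?_⟩
    · rw [mem_support_iff, eq_sub_of_add_eq he, coeff_sub, hwh, coeff_monomial]
      simp
    · intro v hv hvw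
      rw [mem_support_iff, eq_sub_of_add_eq he, coeff_sub, coeff_monomial,
        if_neg (Ne.symm hvw)] at hv
      exact hh' v (by simpa using hv)
  obtain ⟨φ, h1, h2⟩ := Submodule.exists_le_ker_of_notMem hnot
  refine ⟨φ, fun p hp => h2 (Submodule.mem_sup_left hp), fun v hv => h2 (Submodule.mem_sup_right ?_), h1⟩
  rw [mem_restrictSupport_iff]
  intro a ha
  have := support_monomial_subset ha
  simp at this
  rw [this]; exact hv

/-- If `Q = ⟨x₁^{r₁},…,xₙ^{rₙ}⟩ ⊆ I` (with all `rᵢ ≥ 1`), then for every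
term order `≺` we have `in_≺(Q : I) = (Q : in_≺(I))`. -/
theorem initialIdeal_colon {n : ℕ} {K : Type*} [Field K]
    (r : Fin n → ℕ) (hr : ∀ i, 1 ≤ r i)
    (Q : Ideal (MvPolynomial (Fin n) K))
    (hQ : Q = Ideal.span (Set.range fun i : Fin n =>
      monomial (Finsupp.single i (r i)) (1 : K)))
    (I : Ideal (MvPolynomial (Fin n) K)) (hQI : Q ≤ I)
    (lt : (Fin n →₀ ℕ) → (Fin n →₀ ℕ) → Prop) (hlt : IsTermOrder n lt) :
    initialIdeal lt (Q.colon I) = Q.colon (initialIdeal lt I) := by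
  obtain ⟨s, hs⟩ : ∃ s : Fin n →₀ ℕ, ∀ i, s i = r i - 1 :=
    ⟨Finsupp.equivFunOnFinite.symm fun i => r i - 1, fun i => rfl⟩
  have hmem : ∀ p, p ∈ Q ↔ ∀ b, b ≤ s → coeff b p = 0 := fun p => by
    rw [hQ]; exact mem_Q_iff r hr s hs p
  have hmon : ∀ b, ¬ b ≤ s → monomial b (1 : K) ∈ Q := by
    intro b hb
    rw [hmem]
    intro c hc
    rw [coeff_monomial, if_neg]
    rintro rfl; exact hb hc
  apply le_antisymm
  · unfold initialIdeal
    rw [Ideal.span_le]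
    rintro _ ⟨f, hf, u, hu, rfl⟩
    rw [SetLike.mem_coe, Submodule.mem_colon]
    intro q hq
    rw [SetLike.mem_coe] at hq
    rw [smul_eq_mul]
    induction hq using Submodule.span_induction with
    | zero => simp
    | add x y _ _ hx hy => rw [mul_add]; exact Q.add_mem hx hy
    | smul a x _ hx => rw [smul_eq_mul, mul_left_comm]; exact Q.mul_mem_left _ hx
    | mem x hx =>
      obtain ⟨g, hg, v, hv, rfl⟩ := hx
      rw [monomial_mul, one_mul]
      apply hmon
      intro hle
      have := Submodule.mem_colon.1 hf g hg
      rw [smul_eq_mul, hmem] at this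
      exact coeff_lead hlt hu hv (this _ hle)
  · intro p hp
    rw [Submodule.mem_colon] at hp
    rw [as_sum p]
    refine Ideal.sum_mem _ fun b hb => ?_
    suffices h : ∃ f ∈ Q.colon (I : Set (MvPolynomial (Fin n) K)), IsLeadExp lt f b by
      obtain ⟨f, hf, hfb⟩ := h
      have : monomial b (coeff b p) = C (coeff b p) * monomial b 1 := by
        rw [C_mul_monomial, mul_one]
      rw [this]
      exact Ideal.mul_mem_left _ _ (Ideal.subset_span ⟨f, hf, b, hfb, rfl⟩)
    by_cases hbs : b ≤ s
    · have hw : ∀ g ∈ I, ¬ IsLeadExp lt g (s - b) := by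
        intro g hg hgl
        have := hp (monomial (s - b) 1) (Ideal.subset_span ⟨g, hg, _, hgl, rfl⟩)
        rw [smul_eq_mul, hmem] at this
        have h2 := this s le_rfl
        rw [coeff_mul_monomial', if_pos tsub_le_self, tsub_tsub_cancel_of_le hbs, mul_one] at h2
        exact mem_support_iff.1 hb h2
      obtain ⟨φ, hI, hlow, hne⟩ := exists_functional hlt I _ hw
      let f : MvPolynomial (Fin n) K :=
        ∑ a ∈ Finset.Iic s, monomial a (φ (monomial (s - a) 1))
      have hf : ∀ a, coeff a f = if a ≤ s then φ (monomial (s - a) 1) else 0 := by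
        intro a
        simp [f, coeff_sum, coeff_monomial]
      have hpair : ∀ q, coeff s (f * q) = φ q := by
        intro q
        have hmonq : ∀ c, coeff s (f * monomial c 1) = φ (monomial c 1) := by
          intro c
          rw [coeff_mul_monomial', mul_one]
          split_ifs with hc
          · rw [hf, if_pos tsub_le_self, tsub_tsub_cancel_of_le hc]
          · exact (hI _ (hQI (hmon c hc))).symm
        induction q using MvPolynomial.induction_on' with
        | monomial c a =>
          have : monomial c a = a • monomial c (1 : K) := by simp [smul_monomial]
          rw [this, mul_smul_comm, coeff_smul, map_smul, hmonq]
        | add x y hx hy => rw [mul_add, coeff_add, map_add, hx, hy]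
      refine ⟨f, ?_, ?_, ?_⟩
      · rw [Submodule.mem_colon]
        intro q hq
        rw [smul_eq_mul, hmem]
        intro c hc
        have := hpair (q * monomial (s - c) 1)
        rw [hI _ (Ideal.mul_mem_right _ _ hq), ← mul_assoc, coeff_mul_monomial',
          if_pos tsub_le_self, tsub_tsub_cancel_of_le hc, mul_one] at this
        exact this
      · rw [mem_support_iff, hf, if_pos hbs]; exact hne
      · intro v hv hvb
        rw [mem_support_iff, hf] at hv
        have hvs : v ≤ s := by by_contra hc; exact hv (if_neg hc)
        rw [if_pos hvs] at hv
        rcases hlt.1 v b with h | h | h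
        · exact h
        · exact absurd h hvb
        · exact absurd (hlow _ (lt_sub hlt hbs hvs h)) hv
    · refine ⟨monomial b 1, ?_, ?_, ?_⟩
      · rw [Submodule.mem_colon]
        intro q _
        exact Ideal.mul_mem_right _ _ (hmon b hbs)
      · simp [mem_support_iff]
      · intro v hv hvb
        have := support_monomial_subset hv
        simp at this
        exact absurd this hvb
end
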